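/- For Lebesgue-almost every real number ξ, the quadratic polynomial f_ξ(z) = z² + exp(2πiξ)·z is locally linearizable at its fixed point 0: there exists h holomorphic on a neighborhood of 0 in ℂ with h(0) = 0 and h'(0) = 1 such that f_ξ(h(w)) = h(exp(2πiξ)·w) for all w in some neighborhood of 0. -/

import Mathlib

open Filter Topology MeasureTheory

/-- The product of the successive differences of a list of natural numbers. -/
def gapProd : List ℕ → ℝ
  | a :: b :: l => ((a : ℝ) - b) * gapProd (b :: l)
  | _ => 1

lemma one_le_gapProd (l : List ℕ) (hl : l.Pairwise (· > ·)) : 1 ≤ gapProd l := by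
  induction l with
  | nil => simp [gapProd]
  | cons a l ih =>
    cases l with
    | nil => simp [gapProd]
    | cons b l =>
      have hab : b < a := (List.pairwise_cons.1 hl).1 b (by simp)
      have h1 : ((b + 1 : ℕ) : ℝ) ≤ a := by exact_mod_cast hab
      push_cast at h1
      have h2 := ih (List.pairwise_cons.1 hl).2
      simp only [gapProd]
      nlinarith

/-- Deleting an entry of a decreasing list costs at most twice the distance to one of the
remaining entries. -/
lemma exists_dist_mul_gapProd_le (x : ℕ) (l₂ : List ℕ) (l₁ : List ℕ)
    (hl : (l₁ ++ x :: l₂).Pairwise (· > ·)) (hne : l₁ ++ l₂ ≠ []) :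
    ∃ y ∈ l₁ ++ l₂, |(x : ℝ) - y| * gapProd (l₁ ++ l₂) ≤ 2 * gapProd (l₁ ++ x :: l₂) := by
  induction l₁ with
  | nil =>
    cases l₂ with
    | nil => simp at hne
    | cons b t =>
      have hxb : b < x := (List.pairwise_cons.1 hl).1 b (by simp)
      have h1 : (b : ℝ) < x := by exact_mod_cast hxb
      have h2 := one_le_gapProd (b :: t) (List.pairwise_cons.1 hl).2
      refine ⟨b, by simp, ?_⟩
      simp only [List.nil_append, gapProd]
      rw [abs_of_pos (by linarith)]
      nlinarith [mul_pos (sub_pos.2 h1) (lt_of_lt_of_le one_pos h2)]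
  | cons a s ih =>
    cases s with
    | nil =>
      have hax : x < a := (List.pairwise_cons.1 hl).1 x (by simp)
      have h1 : (x : ℝ) < a := by exact_mod_cast hax
      cases l₂ with
      | nil =>
        refine ⟨a, by simp, ?_⟩
        simp only [List.nil_append, List.cons_append, gapProd]
        rw [abs_of_neg (by linarith)]
        linarith
      | cons b t =>
        have hxb : b < x := (List.pairwise_cons.1 (List.pairwise_cons.1 hl).2).1 b (by simp)
        have h2 : (b : ℝ) < x := by exact_mod_cast hxb
        have h3 := one_le_gapProd (b :: t) (List.pairwise_cons.1 (List.pairwise_cons.1 hl).2).2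
        simp only [List.nil_append, List.cons_append, gapProd]
        rcases le_total ((a : ℝ) - x) (x - b) with h | h
        · refine ⟨a, by simp, ?_⟩
          rw [abs_of_neg (by linarith), ← mul_assoc, ← mul_assoc, ← mul_assoc]
          exact mul_le_mul_of_nonneg_right (by nlinarith) (by linarith)
        · refine ⟨b, by simp, ?_⟩
          rw [abs_of_pos (by linarith), ← mul_assoc, ← mul_assoc, ← mul_assoc]
          exact mul_le_mul_of_nonneg_right (by nlinarith) (by linarith)
    | cons a' s =>
      obtain ⟨y, hy, h⟩ := ih (List.pairwise_cons.1 hl).2 (by simp)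
      refine ⟨y, List.mem_cons_of_mem _ hy, ?_⟩
      have haa : a' < a := (List.pairwise_cons.1 hl).1 a' (by simp)
      have h1 : (a' : ℝ) < a := by exact_mod_cast haa
      simp only [List.cons_append, gapProd] at h ⊢
      nlinarith

/-- Small divisors indexed by a decreasing list cannot all be small. -/
lemma prod_le_of_pairwise_min_le {e : ℕ → ℝ} {C : ℝ} (hC : 1 ≤ C) (he0 : ∀ k, 0 ≤ e k)
    (he1 : ∀ k, 2 ≤ k → e k ≤ C * k ^ 2)
    (he2 : ∀ k l, 2 ≤ k → 2 ≤ l → k ≠ l → min (e k) (e l) ≤ C * ((k : ℝ) - l) ^ 2)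
    {A : ℕ} (n : ℕ) : ∀ l : List ℕ, l.length = n + 1 → l.Pairwise (· > ·) →
      (∀ k ∈ l, 2 ≤ k ∧ k ≤ A) →
      (l.map e).prod ≤ (4 * C) ^ (n + 1) * (A * gapProd l) ^ 2 := by
  induction n with
  | zero =>
    intro l hlen _ hA
    obtain ⟨a, rfl⟩ := List.length_eq_one_iff.1 hlen
    have := hA a (by simp)
    have h1 : (a : ℝ) ≤ A := by exact_mod_cast this.2
    have h2 := he1 a this.1
    simp only [List.map_cons, List.map_nil, List.prod_cons, List.prod_nil, mul_one, gapProd]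
    calc e a ≤ C * (a : ℝ) ^ 2 := h2
      _ ≤ C * (A : ℝ) ^ 2 := by gcongr
      _ ≤ (4 * C) ^ (0 + 1) * (A : ℝ) ^ 2 := by rw [zero_add, pow_one]; gcongr; linarith
  | succ n ih =>
    intro l hlen hl hA
    obtain ⟨x, hx, hmin⟩ := l.toFinset.exists_min_image e
      (by rw [List.toFinset_nonempty_iff]; rintro rfl; simp at hlen)
    rw [List.mem_toFinset] at hx
    obtain ⟨l₁, l₂, rfl⟩ := List.append_of_mem hx
    have hlen' : (l₁ ++ l₂).length = n + 1 := by
      simp only [List.length_append, List.length_cons] at hlen ⊢; omega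
    have hsub : (l₁ ++ l₂).Sublist (l₁ ++ x :: l₂) :=
      (List.Sublist.refl l₁).append (List.sublist_cons_self x l₂)
    obtain ⟨y, hy, hyg⟩ := exists_dist_mul_gapProd_le x l₂ l₁ hl
      (by intro h; rw [h] at hlen'; simp at hlen')
    have hih := ih (l₁ ++ l₂) hlen' (hl.sublist hsub) (fun k hk => hA k (hsub.subset hk))
    have hxy : x ≠ y := by
      rintro rfl
      have := hl.imp (fun h => ne_of_gt h)
      have hnd : (l₁ ++ x :: l₂).Nodup := this
      rw [List.nodup_middle] at hnd
      exact (List.nodup_cons.1 hnd).1 hy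
    have hex : e x ≤ C * ((x : ℝ) - y) ^ 2 := by
      have := he2 x y (hA x hx).1 (hA y (hsub.subset hy)).1 hxy
      rwa [min_eq_left (hmin y (List.mem_toFinset.2 (hsub.subset hy)))] at this
    have hprod : ((l₁ ++ x :: l₂).map e).prod = e x * ((l₁ ++ l₂).map e).prod := by
      simp only [List.map_append, List.map_cons, List.prod_append, List.prod_cons]; ring
    have hg := one_le_gapProd _ (hl.sublist hsub)
    have hp0 : 0 ≤ ((l₁ ++ l₂).map e).prod :=
      List.prod_nonneg (by simp only [List.mem_map]; rintro _ ⟨k, _, rfl⟩; exact he0 k)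
    rw [hprod]
    calc e x * ((l₁ ++ l₂).map e).prod
        ≤ (C * ((x : ℝ) - y) ^ 2) * ((4 * C) ^ (n + 1) * (A * gapProd (l₁ ++ l₂)) ^ 2) := by
          gcongr
      _ = C * (4 * C) ^ (n + 1) * A ^ 2 * (|(x : ℝ) - y| * gapProd (l₁ ++ l₂)) ^ 2 := by
          rw [mul_pow |(x : ℝ) - y|, sq_abs]; ring
      _ ≤ C * (4 * C) ^ (n + 1) * A ^ 2 * (2 * gapProd (l₁ ++ x :: l₂)) ^ 2 := by
          gcongr
      _ = _ := by ring

/-- `TreeWeight e k v`: the weight of some binary tree with `k` leaves is `v`, where every inner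
node above `m` leaves contributes the factor `e m`. -/
inductive TreeWeight (e : ℕ → ℝ) : ℕ → ℝ → Prop
  | leaf : TreeWeight e 1 1
  | node {i j : ℕ} {v w : ℝ} : TreeWeight e i v → TreeWeight e j w →
      TreeWeight e (i + j) (e (i + j) * (v * w))

lemma TreeWeight.one_le {e : ℕ → ℝ} {k : ℕ} {v : ℝ} (h : TreeWeight e k v) : 1 ≤ k := by
  induction h <;> omega

lemma TreeWeight.nonneg {e : ℕ → ℝ} (he0 : ∀ k, 0 ≤ e k) {k : ℕ} {v : ℝ}
    (h : TreeWeight e k v) : 0 ≤ v := by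
  induction h with
  | leaf => exact zero_le_one
  | node _ _ h1 h2 => exact mul_nonneg (he0 _) (mul_nonneg h1 h2)

lemma TreeWeight.eq_one {e : ℕ → ℝ} {v : ℝ} (h : TreeWeight e 1 v) : v = 1 := by
  generalize hk : 1 = k at h
  cases h with
  | leaf => rfl
  | node h1 h2 => have := h1.one_le; have := h2.one_le; omega

/-- The outcome of following the subtrees with more than `K` leaves down from the root:
their sizes form the decreasing list `k :: l`, and the last one splits into `i ≤ j` leaves. -/
def ChainBound (e : ℕ → ℝ) (Q : ℝ) (K k : ℕ) (v : ℝ) : Prop :=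
  ∃ (l : List ℕ) (i j : ℕ), (k :: l).Pairwise (· > ·) ∧ (∀ m ∈ k :: l, K < m) ∧
    1 ≤ i ∧ 1 ≤ j ∧ j ≤ K ∧ K < 2 * j ∧ l.length + 2 ≤ k ∧
    (k : ℝ) - j ≤ 2 ^ l.length * (gapProd (k :: l) * i) ∧
    v * (gapProd (k :: l) * i * j) ^ 4 ≤ ((k :: l).map e).prod * Q ^ (k - (l.length + 2))

lemma ChainBound.split {e : ℕ → ℝ} {Q : ℝ} (he0 : ∀ k, 0 ≤ e k) {K i j : ℕ} {v w : ℝ}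
    (hi : 1 ≤ i) (hij : i ≤ j) (hjK : j ≤ K) (hK : K < i + j) (hw0 : 0 ≤ w) (hQ : 1 ≤ Q)
    (hv : v * (i : ℝ) ^ 4 ≤ Q ^ (i - 1)) (hw : w * (j : ℝ) ^ 4 ≤ Q ^ (j - 1)) :
    ChainBound e Q K (i + j) (e (i + j) * (v * w)) := by
  refine ⟨[], i, j, by simp, by simpa using hK, hi, hi.trans hij, hjK, by omega,
    by simp; omega, by simp [gapProd], ?_⟩
  have hexp : Q ^ (i + j - 2) = Q ^ (i - 1) * Q ^ (j - 1) := by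
    rw [← pow_add]; congr 1; omega
  simp only [gapProd, List.map_cons, List.map_nil, List.prod_cons, List.prod_nil, mul_one,
    one_mul, List.length_nil, zero_add, hexp]
  have := he0 (i + j)
  calc e (i + j) * (v * w) * ((i : ℝ) * j) ^ 4
      = e (i + j) * ((v * (i : ℝ) ^ 4) * (w * (j : ℝ) ^ 4)) := by ring
    _ ≤ _ := by gcongr

lemma ChainBound.cons {e : ℕ → ℝ} {Q : ℝ} (he0 : ∀ k, 0 ≤ e k) {K i j : ℕ} {v w : ℝ}
    (hj : 1 ≤ j) (hw0 : 0 ≤ w) (hQ : 1 ≤ Q) (h : ChainBound e Q K i v)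
    (hw : w * (j : ℝ) ^ 4 ≤ Q ^ (j - 1)) :
    ChainBound e Q K (i + j) (e (i + j) * (v * w)) := by
  obtain ⟨l, a, b, hl, hm, ha, hb, hbK, hKb, hlen, hg, hv⟩ := h
  have hgp := one_le_gapProd _ hl
  have hKi : K < i := hm i (by simp)
  have hcons : gapProd ((i + j) :: i :: l) = j * gapProd (i :: l) := by
    simp [gapProd]
  refine ⟨i :: l, a, b, ?_, ?_, ha, hb, hbK, hKb, ?_, ?_, ?_⟩
  · refine List.pairwise_cons.2 ⟨fun m hmem => ?_, hl⟩
    rcases List.mem_cons.1 hmem with rfl | h'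
    · omega
    · have := (List.pairwise_cons.1 hl).1 m h'; omega
  · intro m hmem
    rcases List.mem_cons.1 hmem with rfl | h'
    · omega
    · exact hm m h'
  · simp only [List.length_cons]; omega
  · rw [hcons, List.length_cons, pow_succ]
    push_cast
    have h1 : (1 : ℝ) ≤ j := by exact_mod_cast hj
    have h2 : (1 : ℝ) ≤ a := by exact_mod_cast ha
    have h3 : (1 : ℝ) ≤ 2 ^ l.length * (gapProd (i :: l) * a) :=
      one_le_mul_of_one_le_of_one_le (one_le_pow₀ one_le_two)
        (one_le_mul_of_one_le_of_one_le hgp h2)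
    nlinarith
  · have hexp : Q ^ (i + j - ((i :: l).length + 2)) = Q ^ (i - (l.length + 2)) * Q ^ (j - 1) := by
      rw [← pow_add, List.length_cons]; congr 1; omega
    rw [hcons, hexp, List.map_cons, List.prod_cons]
    have := he0 (i + j)
    have hp0 : 0 ≤ ((i :: l).map e).prod :=
      List.prod_nonneg (by simp only [List.mem_map]; rintro _ ⟨k, _, rfl⟩; exact he0 k)
    calc e (i + j) * (v * w) * ((j : ℝ) * gapProd (i :: l) * a * b) ^ 4
        = e (i + j) * ((v * (gapProd (i :: l) * a * b) ^ 4) * (w * (j : ℝ) ^ 4)) := by ring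
      _ ≤ e (i + j) * ((((i :: l).map e).prod * Q ^ (i - (l.length + 2))) * Q ^ (j - 1)) := by
          gcongr
      _ = _ := by ring

lemma TreeWeight.chainBound {e : ℕ → ℝ} {Q : ℝ} (he0 : ∀ k, 0 ≤ e k) (hQ : 1 ≤ Q) {K : ℕ}
    (hK : 1 ≤ K) (H : ∀ i v, i ≤ K → TreeWeight e i v → v * (i : ℝ) ^ 4 ≤ Q ^ (i - 1))
    {k : ℕ} {v : ℝ} (h : TreeWeight e k v) (hKk : K < k) (hk : k ≤ 2 * K) :
    ChainBound e Q K k v := by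
  induction h with
  | leaf => omega
  | @node i j v w hi hj ihi ihj =>
    have hi1 := hi.one_le
    have hj1 := hj.one_le
    by_cases h1 : K < i
    · exact (ihi h1 (by omega)).cons he0 hj1 (hj.nonneg he0) hQ (H j w (by omega) hj)
    by_cases h2 : K < j
    · rw [add_comm i j, mul_comm v w]
      exact (ihj h2 (by omega)).cons he0 hi1 (hi.nonneg he0) hQ (H i v (by omega) hi)
    push Not at h1 h2
    rcases le_total i j with h | h
    · exact .split he0 hi1 h h2 hKk (hj.nonneg he0) hQ (H i v h1 hi) (H j w h2 hj)
    · rw [add_comm i j, mul_comm v w]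
      exact .split he0 hj1 h h1 (by omega) (hi.nonneg he0) hQ (H j w h2 hj) (H i v h1 hi)

lemma TreeWeight.mul_pow_le {e : ℕ → ℝ} {C : ℝ} (hC : 1 ≤ C) (he0 : ∀ k, 0 ≤ e k)
    (he1 : ∀ k, 2 ≤ k → e k ≤ C * k ^ 2)
    (he2 : ∀ k l, 2 ≤ k → 2 ≤ l → k ≠ l → min (e k) (e l) ≤ C * ((k : ℝ) - l) ^ 2)
    (k : ℕ) : ∀ v, TreeWeight e k v → v * (k : ℝ) ^ 4 ≤ (16384 * C) ^ (k - 1) := by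
  induction k using Nat.strong_induction_on with
  | _ k ih =>
  intro v hv
  have hk1 := hv.one_le
  obtain rfl | hk2 := hk1.eq_or_lt
  · simp [hv.eq_one]
  have hQ : 1 ≤ 16384 * C := by linarith
  obtain ⟨l, i, j, hl, hm, hi, hj, hjK, hKj, hlen, hg, hb⟩ :=
    hv.chainBound (K := (k + 1) / 2) he0 hQ (by omega)
      (fun i v hi h => ih i (by omega) v h) (by omega) (by omega)
  have hprod := prod_le_of_pairwise_min_le hC he0 he1 he2 (A := k) l.length (k :: l) rfl hl
    (fun m hmem => ⟨by have := hm m hmem; omega, by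
      rcases List.mem_cons.1 hmem with rfl | h'
      · exact le_rfl
      · exact ((List.pairwise_cons.1 hl).1 m h').le⟩)
  have hgp := one_le_gapProd _ hl
  have hv0 := hv.nonneg he0
  set g := gapProd (k :: l)
  set r := l.length
  have hi' : (1 : ℝ) ≤ i := by exact_mod_cast hi
  have hj' : (1 : ℝ) ≤ j := by exact_mod_cast hj
  have hk4 : (k : ℝ) ≤ 4 * j := by
    have : k ≤ 4 * j := by omega
    exact_mod_cast this
  have hkj : (k : ℝ) ≤ 3 * (k - j) := by
    have : 3 * j ≤ 2 * k := by omega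
    have : (3 : ℝ) * j ≤ 2 * k := by exact_mod_cast this
    linarith
  have hk3 : (k : ℝ) ≤ 4 ^ (r + 1) * (g * i) := by
    have : (3 : ℝ) * 2 ^ r ≤ 4 ^ (r + 1) := by
      have : (2 : ℝ) ^ r ≤ 4 ^ r := by gcongr; norm_num
      rw [pow_succ]; nlinarith [show (0 : ℝ) ≤ 2 ^ r by positivity]
    calc (k : ℝ) ≤ 3 * (2 ^ r * (g * i)) := by linarith
      _ = (3 * 2 ^ r) * (g * i) := by ring
      _ ≤ _ := by gcongr
  have hkey : (k : ℝ) ^ 6 ≤ 4096 ^ (r + 1) * (g ^ 2 * (i : ℝ) ^ 4 * (j : ℝ) ^ 4) := by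
    have h2 : (i : ℝ) ^ 2 ≤ (i : ℝ) ^ 4 := pow_le_pow_right₀ hi' (by norm_num)
    have h3 : (4 : ℝ) ^ 4 ≤ 256 ^ (r + 1) := by
      calc (4 : ℝ) ^ 4 = 256 ^ 1 := by norm_num
        _ ≤ _ := pow_le_pow_right₀ (by norm_num) (by omega)
    calc (k : ℝ) ^ 6 = (k : ℝ) ^ 2 * (k : ℝ) ^ 4 := by ring
      _ ≤ (4 ^ (r + 1) * (g * i)) ^ 2 * (4 * j) ^ 4 := by gcongr
      _ = (4 ^ (r + 1)) ^ 2 * 4 ^ 4 * (g ^ 2 * (i : ℝ) ^ 2 * (j : ℝ) ^ 4) := by ring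
      _ ≤ (4 ^ (r + 1)) ^ 2 * 256 ^ (r + 1) * (g ^ 2 * (i : ℝ) ^ 4 * (j : ℝ) ^ 4) := by gcongr
      _ = _ := by
          rw [← pow_mul, mul_comm (r + 1) 2, pow_mul, ← mul_pow]; norm_num
  have hpos : 0 < (g * i * j) ^ 4 := by positivity
  refine le_of_mul_le_mul_right ?_ hpos
  have hexp : (16384 * C) ^ (k - 1) = (16384 * C) ^ (r + 1) * (16384 * C) ^ (k - (r + 2)) := by
    rw [← pow_add]; congr 1; omega
  have hC0 : 0 ≤ C := by linarith
  calc v * (k : ℝ) ^ 4 * (g * i * j) ^ 4 = (k : ℝ) ^ 4 * (v * (g * i * j) ^ 4) := by ring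
    _ ≤ (k : ℝ) ^ 4 * (((4 * C) ^ (r + 1) * (k * g) ^ 2) * (16384 * C) ^ (k - (r + 2))) := by
        refine mul_le_mul_of_nonneg_left (hb.trans ?_) (by positivity)
        gcongr
    _ = (4 * C) ^ (r + 1) * g ^ 2 * (16384 * C) ^ (k - (r + 2)) * (k : ℝ) ^ 6 := by ring
    _ ≤ (4 * C) ^ (r + 1) * g ^ 2 * (16384 * C) ^ (k - (r + 2)) *
          (4096 ^ (r + 1) * (g ^ 2 * (i : ℝ) ^ 4 * (j : ℝ) ^ 4)) := by gcongr
    _ = _ := by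
        rw [hexp, show (16384 * C) ^ (r + 1) = (4 * C) ^ (r + 1) * 4096 ^ (r + 1) by
          rw [← mul_pow]; congr 1; ring]
        ring

/-- The coefficients of the formal linearization: `siegelCoeff l n` is the coefficient of
`w ^ (n + 1)` in the series `h` with `h (l * w) = h w ^ 2 + l * h w`. -/
noncomputable def siegelCoeff (l : ℂ) : ℕ → ℂ
  | 0 => 1
  | n + 1 => (∑ i : Fin (n + 1), siegelCoeff l i * siegelCoeff l (n - i)) / (l ^ (n + 2) - l)

lemma siegelCoeff_succ (l : ℂ) (n : ℕ) :
    siegelCoeff l (n + 1) = (∑ ij ∈ Finset.HasAntidiagonal.antidiagonal n,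
      siegelCoeff l ij.1 * siegelCoeff l ij.2) / (l ^ (n + 2) - l) := by
  rw [siegelCoeff, Finset.Nat.sum_antidiagonal_eq_sum_range_succ
    (fun x y => siegelCoeff l x * siegelCoeff l y) n, Finset.sum_range]

lemma exists_treeWeight_norm_siegelCoeff_le (l : ℂ) (n : ℕ) :
    ∃ v, TreeWeight (fun k => ‖l ^ k - l‖⁻¹) (n + 1) v ∧
      ‖siegelCoeff l n‖ ≤ catalan n * v := by
  set e : ℕ → ℝ := fun k => ‖l ^ k - l‖⁻¹ with he
  have he0 : ∀ k, 0 ≤ e k := fun k => inv_nonneg.2 (norm_nonneg _)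
  induction n using Nat.strong_induction_on with
  | _ n ih =>
  cases n with
  | zero => exact ⟨1, .leaf, by simp [siegelCoeff]⟩
  | succ n =>
    have ih' : ∀ m, ∃ v, m ≤ n → TreeWeight e (m + 1) v ∧ ‖siegelCoeff l m‖ ≤ catalan m * v := by
      intro m
      by_cases hm : m ≤ n
      · obtain ⟨v, hv⟩ := ih m (by omega)
        exact ⟨v, fun _ => hv⟩
      · exact ⟨0, fun h => absurd h hm⟩
    choose M hM using ih'
    obtain ⟨ij, hij, hmax⟩ := (Finset.HasAntidiagonal.antidiagonal n).exists_max_image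
      (fun ij => M ij.1 * M ij.2) ⟨(0, n), by simp⟩
    have hle : ∀ ij ∈ Finset.HasAntidiagonal.antidiagonal n, ij.1 ≤ n ∧ ij.2 ≤ n := by
      intro ij h
      rw [Finset.HasAntidiagonal.mem_antidiagonal] at h
      omega
    refine ⟨e (n + 1 + 1) * (M ij.1 * M ij.2), ?_, ?_⟩
    · have := TreeWeight.node (hM _ (hle ij hij).1).1 (hM _ (hle ij hij).2).1
      have h2 : ij.1 + 1 + (ij.2 + 1) = n + 1 + 1 := by
        have := Finset.HasAntidiagonal.mem_antidiagonal.1 hij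
        omega
      rwa [h2] at this
    · rw [siegelCoeff_succ, norm_div, div_eq_mul_inv, catalan_succ']
      have : ‖∑ ij ∈ Finset.HasAntidiagonal.antidiagonal n, siegelCoeff l ij.1 * siegelCoeff l ij.2‖ ≤
          ∑ ab ∈ Finset.HasAntidiagonal.antidiagonal n,
            ((catalan ab.1 * catalan ab.2 : ℕ) : ℝ) * (M ij.1 * M ij.2) := by
        refine (norm_sum_le _ _).trans (Finset.sum_le_sum fun ab hab => ?_)
        obtain ⟨h1, h2⟩ := hle ab hab
        rw [norm_mul]
        calc ‖siegelCoeff l ab.1‖ * ‖siegelCoeff l ab.2‖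
            ≤ (catalan ab.1 * M ab.1) * (catalan ab.2 * M ab.2) := by
              gcongr
              · exact (norm_nonneg _).trans (hM _ h1).2
              · exact (hM _ h1).2
              · exact (hM _ h2).2
          _ = ((catalan ab.1 * catalan ab.2 : ℕ) : ℝ) * (M ab.1 * M ab.2) := by
              push_cast; ring
          _ ≤ _ := by
              exact mul_le_mul_of_nonneg_left (hmax ab hab) (Nat.cast_nonneg _)
      rw [← Finset.sum_mul] at this
      push_cast at this ⊢
      calc _ ≤ _ := mul_le_mul_of_nonneg_right this (inv_nonneg.2 (norm_nonneg _))
        _ = _ := by simp only [he]; ring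

lemma norm_siegelCoeff_le {l : ℂ} (hl : ‖l‖ = 1) {c : ℝ} (hc0 : 0 < c) (hc1 : c ≤ 1)
    (hc : ∀ n : ℕ, 1 ≤ n → c / (n : ℝ) ^ 2 ≤ ‖l ^ n - 1‖) (n : ℕ) :
    ‖siegelCoeff l n‖ ≤ (4 * (16384 * (2 / c))) ^ n := by
  obtain ⟨v, hv, hle⟩ := exists_treeWeight_norm_siegelCoeff_le l n
  have he0 : ∀ k : ℕ, 0 ≤ ‖l ^ k - l‖⁻¹ := fun k => inv_nonneg.2 (norm_nonneg _)
  have hC : 1 ≤ 2 / c := by rw [le_div_iff₀ hc0]; linarith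
  have hgap : ∀ k m : ℕ, m < k → c / ((k : ℝ) - m) ^ 2 ≤ ‖l ^ k - l ^ m‖ := by
    intro k m hkm
    have h1 := hc (k - m) (by omega)
    rw [Nat.cast_sub hkm.le] at h1
    have h2 : l ^ k - l ^ m = l ^ m * (l ^ (k - m) - 1) := by
      rw [mul_sub, ← pow_add, mul_one]; congr 2; omega
    rwa [h2, norm_mul, norm_pow, hl, one_pow, one_mul]
  have hmin : ∀ k m : ℕ, m < k → min (‖l ^ k - l‖⁻¹) (‖l ^ m - l‖⁻¹) ≤
      2 / c * ((k : ℝ) - m) ^ 2 := by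
    intro k m hkm
    have hd : (0 : ℝ) < (k : ℝ) - m := sub_pos.2 (by exact_mod_cast hkm)
    have h1 := hgap k m hkm
    have h2 : ‖l ^ k - l ^ m‖ ≤ ‖l ^ k - l‖ + ‖l ^ m - l‖ := by
      rw [show l ^ k - l ^ m = (l ^ k - l) - (l ^ m - l) by ring]
      exact norm_sub_le _ _
    have hpos : 0 < c / (2 * ((k : ℝ) - m) ^ 2) := by positivity
    have heq : 2 / c * ((k : ℝ) - m) ^ 2 = (c / (2 * ((k : ℝ) - m) ^ 2))⁻¹ := by
      rw [inv_div]; ring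
    have hhalf : c / ((k : ℝ) - m) ^ 2 = 2 * (c / (2 * ((k : ℝ) - m) ^ 2)) := by
      field_simp
    rw [heq]
    by_cases h : c / (2 * ((k : ℝ) - m) ^ 2) ≤ ‖l ^ k - l‖
    · exact (min_le_left _ _).trans (inv_anti₀ hpos h)
    · exact (min_le_right _ _).trans (inv_anti₀ hpos (by linarith))
  have hbound := hv.mul_pow_le hC he0 (fun k hk => ?_) (fun k m _ _ hne => ?_)
  · have hQ : 0 ≤ 16384 * (2 / c) := by positivity
    have hv0 := hv.nonneg he0
    have h1 : v ≤ (16384 * (2 / c)) ^ n := by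
      have : (1 : ℝ) ≤ ((n + 1 : ℕ) : ℝ) ^ 4 :=
        one_le_pow₀ (by push_cast; linarith [n.cast_nonneg (α := ℝ)])
      rw [Nat.add_sub_cancel] at hbound
      nlinarith
    have h2 : (catalan n : ℝ) ≤ 4 ^ n := by
      have : catalan n ≤ 4 ^ n := by
        rw [catalan_eq_centralBinom_div]
        exact (Nat.div_le_self _ _).trans (Nat.centralBinom_le_four_pow n)
      exact_mod_cast this
    rw [mul_pow]
    exact hle.trans (by gcongr)
  · have h1 := hgap k 1 (by omega)
    rw [pow_one, Nat.cast_one] at h1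
    have hk' : (2 : ℝ) ≤ k := by exact_mod_cast hk
    have hpos : 0 < c / ((k : ℝ) - 1) ^ 2 := by
      have : (0 : ℝ) < (k : ℝ) - 1 := by linarith
      positivity
    calc ‖l ^ k - l‖⁻¹ ≤ (c / ((k : ℝ) - 1) ^ 2)⁻¹ := inv_anti₀ hpos h1
      _ = 1 / c * ((k : ℝ) - 1) ^ 2 := by rw [inv_div]; ring
      _ ≤ 2 / c * (k : ℝ) ^ 2 := by
        gcongr
        · norm_num
        · linarith
        · linarith
  · rcases lt_or_gt_of_ne hne with h | h
    · rw [min_comm, show ((k : ℝ) - m) ^ 2 = ((m : ℝ) - k) ^ 2 by ring]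
      exact hmin m k h
    · exact hmin k m h

/-- A geometric bound on the formal coefficients yields a holomorphic linearization. -/
lemma exists_linearization_of_norm_siegelCoeff_le {l : ℂ} (hl : ‖l‖ = 1)
    (hroot : ∀ n : ℕ, 1 ≤ n → l ^ n ≠ 1) {R : ℝ} (hR : 0 < R)
    (hb : ∀ n, ‖siegelCoeff l n‖ ≤ R ^ n) :
    ∃ h : ℂ → ℂ, AnalyticAt ℂ h 0 ∧ h 0 = 0 ∧ deriv h 0 = 1 ∧
      ∀ᶠ w in 𝓝 (0 : ℂ), (h w) ^ 2 + l * h w = h (l * w) := by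
  set c := siegelCoeff l with hcdef
  have hsum : ∀ w : ℂ, ‖w‖ < R⁻¹ → Summable (fun n => ‖c n * w ^ n‖) := by
    intro w hw
    have hlt : R * ‖w‖ < 1 := by
      calc R * ‖w‖ < R * R⁻¹ := by gcongr
        _ = 1 := mul_inv_cancel₀ hR.ne'
    refine Summable.of_nonneg_of_le (fun _ => norm_nonneg _) (fun n => ?_)
      (summable_geometric_of_lt_one (by positivity) hlt)
    rw [norm_mul, norm_pow, mul_pow]
    gcongr
    exact hb n
  let S : ℂ → ℂ := fun w => ∑' n, c n * w ^ n
  have hball : ∀ᶠ w in 𝓝 (0 : ℂ), ‖w‖ < R⁻¹ := by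
    filter_upwards [Metric.ball_mem_nhds (0 : ℂ) (inv_pos.2 hR)] with w hw
    simpa using hw
  have hS : HasFPowerSeriesAt S (FormalMultilinearSeries.ofScalars ℂ c) 0 := by
    rw [hasFPowerSeriesAt_iff]
    filter_upwards [hball] with w hw
    simp only [FormalMultilinearSeries.coeff_ofScalars, zero_add, smul_eq_mul]
    simpa only [mul_comm] using (hsum w hw).of_norm.hasSum
  have hS0 : S 0 = 1 := by
    have := hS.coeff_zero (fun _ => 0)
    rw [← this]
    simp [FormalMultilinearSeries.ofScalars, hcdef, siegelCoeff]
  have hfun : ∀ w : ℂ, ‖w‖ < R⁻¹ → w * S w ^ 2 + l * S w = l * S (l * w) := by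
    intro w hw
    have hw' : ‖l * w‖ < R⁻¹ := by rwa [norm_mul, hl, one_mul]
    have hsq : S w ^ 2 = ∑' n, (l ^ (n + 2) - l) * c (n + 1) * w ^ n := by
      rw [sq]
      simp only [S]
      rw [tsum_mul_tsum_eq_tsum_sum_antidiagonal_of_summable_norm (hsum w hw) (hsum w hw)]
      refine tsum_congr fun n => ?_
      have hne : l ^ (n + 2) - l ≠ 0 := by
        have hl0 : l ≠ 0 := by rintro rfl; simp at hl
        rw [show l ^ (n + 2) - l = l * (l ^ (n + 1) - 1) by ring]
        exact mul_ne_zero hl0 (sub_ne_zero.2 (hroot _ (by omega)))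
      rw [hcdef, siegelCoeff_succ, mul_div_cancel₀ _ hne, Finset.sum_mul]
      refine Finset.sum_congr rfl fun ij hij => ?_
      rw [← Finset.HasAntidiagonal.mem_antidiagonal.1 hij, pow_add]
      ring
    have hd : l * S (l * w) - l * S w = ∑' n, (l ^ (n + 1) - l) * c n * w ^ n := by
      have h1 := ((hsum _ hw').of_norm.hasSum.mul_left l).sub
        ((hsum _ hw).of_norm.hasSum.mul_left l)
      rw [← h1.tsum_eq]
      refine tsum_congr fun n => ?_
      ring
    have hs : Summable (fun n => (l ^ (n + 1) - l) * c n * w ^ n) := by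
      refine (((hsum _ hw').of_norm.mul_left l).sub ((hsum _ hw).of_norm.mul_left l)).congr ?_
      intro n
      ring
    rw [hs.tsum_eq_zero_add] at hd
    rw [hsq, ← tsum_mul_left]
    have : ∀ n, w * ((l ^ (n + 2) - l) * c (n + 1) * w ^ n) =
        (l ^ (n + 1 + 1) - l) * c (n + 1) * w ^ (n + 1) := fun n => by ring
    simp only [this]
    linear_combination -hd
  refine ⟨fun w => w * S w, analyticAt_id.mul hS.analyticAt, by simp, ?_, ?_⟩
  · have := (hasDerivAt_id' (0 : ℂ)).fun_mul hS.differentiableAt.hasDerivAt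
    simpa [hS0] using this.deriv
  · filter_upwards [hball] with w hw
    linear_combination w * hfun w hw

lemma four_mul_abs_sub_round_le (ξ : ℝ) (n : ℕ) :
    4 * |n * ξ - round (n * ξ)| ≤
      ‖Complex.exp (2 * Real.pi * Complex.I * ξ) ^ n - 1‖ := by
  set t : ℝ := n * ξ - round (n * ξ) with ht
  have hexp : Complex.exp (2 * Real.pi * Complex.I * ξ) ^ n =
      Complex.exp (Complex.I * ((2 * Real.pi * t : ℝ) : ℂ)) := by
    rw [← Complex.exp_nat_mul, Complex.exp_eq_exp_iff_exists_int]
    refine ⟨round (n * ξ), ?_⟩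
    rw [ht]
    push_cast
    ring
  have h1 : |t| ≤ 1 / 2 := abs_sub_round _
  have hpi := Real.pi_pos
  have h2 : |Real.pi * t| ≤ Real.pi / 2 := by
    rw [abs_mul, abs_of_pos hpi]; nlinarith
  have h3 := Real.mul_abs_le_abs_sin h2
  rw [hexp, Complex.norm_exp_I_mul_ofReal_sub_one, norm_mul, Real.norm_eq_abs, Real.norm_eq_abs,
    abs_two, show 2 * Real.pi * t / 2 = Real.pi * t by ring]
  have h4 : 2 / Real.pi * |Real.pi * t| = 2 * |t| := by
    rw [abs_mul, abs_of_pos hpi]; field_simp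
  linarith

/-- Almost every rotation number satisfies a Diophantine condition of exponent two. -/
lemma ae_exists_div_sq_le_abs_sub_round :
    ∀ᵐ ξ : ℝ, ∃ c : ℝ, 0 < c ∧ c ≤ 1 ∧
      ∀ n : ℕ, 1 ≤ n → c / (n : ℝ) ^ 2 ≤ |n * ξ - round (n * ξ)| := by
  have hirr : ∀ᵐ ξ : ℝ, Irrational ξ := by
    have := (Set.countable_range ((↑) : ℚ → ℝ)).ae_notMem volume
    exact this
  filter_upwards [ae_not_liouvilleWith, hirr] with ξ hξ hirr
  have h := hξ 3 (by norm_num)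
  simp only [LiouvilleWith, not_exists] at h
  have h1 := h 1
  rw [Filter.not_frequently, Filter.eventually_atTop] at h1
  obtain ⟨N, hN⟩ := h1
  have hne : ∀ n : ℕ, 1 ≤ n → ∀ m : ℤ, (n : ℝ) * ξ ≠ m := fun n hn m h =>
    (hirr.natCast_mul (by omega : n ≠ 0)).ne_int m h
  have hpos : ∀ n : ℕ, 1 ≤ n → 0 < |n * ξ - round (n * ξ)| := fun n hn =>
    abs_pos.2 (sub_ne_zero.2 (hne n hn _))
  have hfin : ∀ M : ℕ, ∃ c : ℝ, 0 < c ∧ c ≤ 1 ∧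
      ∀ n : ℕ, 1 ≤ n → n < M → c ≤ |n * ξ - round (n * ξ)| := by
    intro M
    induction M with
    | zero => exact ⟨1, one_pos, le_rfl, by simp⟩
    | succ M ih =>
      obtain ⟨c, hc0, hc1, hc⟩ := ih
      by_cases hM : 1 ≤ M
      · refine ⟨min c |M * ξ - round (M * ξ)|, lt_min hc0 (hpos M hM),
          (min_le_left _ _).trans hc1, fun n hn hnM => ?_⟩
        rcases (Nat.lt_succ_iff.1 hnM).lt_or_eq with h' | rfl
        · exact (min_le_left _ _).trans (hc n hn h')
        · exact min_le_right _ _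
      · exact ⟨c, hc0, hc1, fun n hn hnM => by omega⟩
  obtain ⟨c, hc0, hc1, hc⟩ := hfin N
  refine ⟨c, hc0, hc1, fun n hn => ?_⟩
  have hn' : (1 : ℝ) ≤ n := by exact_mod_cast hn
  rcases lt_or_ge n N with hnN | hnN
  · exact (div_le_self hc0.le (one_le_pow₀ hn')).trans (hc n hn hnN)
  · have h2 := not_exists.1 (hN n hnN) (round (n * ξ))
    have hn0 : (0 : ℝ) < n := by linarith
    rw [not_and, not_lt] at h2
    have h3 := h2 (fun h => hne n hn (round (n * ξ)) (by
      rw [eq_div_iff hn0.ne'] at h; linarith))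
    rw [show (3 : ℝ) = ((3 : ℕ) : ℝ) by norm_num, Real.rpow_natCast] at h3
    have h4 : |n * ξ - round (n * ξ)| = n * |ξ - round (n * ξ) / n| := by
      rw [← abs_of_pos hn0, ← abs_mul, abs_of_pos hn0, mul_sub, mul_div_cancel₀ _ hn0.ne']
    rw [h4]
    calc c / (n : ℝ) ^ 2 ≤ 1 / (n : ℝ) ^ 2 := by gcongr
      _ = n * (1 / (n : ℝ) ^ 3) := by field_simp
      _ ≤ _ := by gcongr

/-- Theorem 8.6 (Siegel, Yoccoz): for Lebesgue-almost every angle `ξ`, the quadratic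
map `z ↦ z² + e^{2πiξ} z` is locally linearizable at the origin (possesses a Siegel
disk). -/
theorem quadratic_siegel_disk_ae :
    ∀ᵐ ξ : ℝ, ∃ h : ℂ → ℂ, AnalyticAt ℂ h 0 ∧ h 0 = 0 ∧ deriv h 0 = 1 ∧
      ∀ᶠ w in 𝓝 (0 : ℂ),
        (h w) ^ 2 + Complex.exp (2 * Real.pi * Complex.I * ξ) * h w
          = h (Complex.exp (2 * Real.pi * Complex.I * ξ) * w) := by
  filter_upwards [ae_exists_div_sq_le_abs_sub_round] with ξ hξ
  obtain ⟨c, hc0, hc1, hc⟩ := hξ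
  set l := Complex.exp (2 * Real.pi * Complex.I * ξ) with hl_def
  have hl : ‖l‖ = 1 := by
    rw [hl_def, show 2 * Real.pi * Complex.I * ξ = ((2 * Real.pi * ξ : ℝ) : ℂ) * Complex.I by
      push_cast; ring]
    exact Complex.norm_exp_ofReal_mul_I _
  have hdiv : ∀ n : ℕ, 1 ≤ n → c / (n : ℝ) ^ 2 ≤ ‖l ^ n - 1‖ := fun n hn => by
    have h1 := four_mul_abs_sub_round_le ξ n
    have h2 := hc n hn
    linarith [abs_nonneg ((n : ℝ) * ξ - round (n * ξ))]
  refine exists_linearization_of_norm_siegelCoeff_le hl (fun n hn h => ?_)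
    (by positivity) (norm_siegelCoeff_le hl hc0 hc1 hdiv)
  have h1 := hdiv n hn
  rw [h, sub_self, norm_zero] at h1
  have : (0 : ℝ) < n := by exact_mod_cast hn
  have : 0 < c / (n : ℝ) ^ 2 := by positivity
  linarith
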